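/- Let α ∈ [4/3, 2). For every correlation clustering instance on a nonempty finite set V, every cluster LP solution z on V, and every triangle T = (u,v,w) on three distinct vertices of V exactly one of whose pairs uv, uw, vw is a +pair (the other two being -pairs), one has cost(T) ≤ Delta(T), where cost and Delta are defined with parameter α and threshold τ = 0.4. -/

import Mathlib

open Finset
open scoped Classical

variable {V : Type*} [Fintype V] [DecidableEq V]

/-- A cluster LP solution on `V`: a nonnegative weight on every nonempty subset of `V`
such that for every vertex `u`, the total weight of sets containing `u` is `1`. -/
def IsClusterLP (z : Finset V → ℝ) : Prop :=
  (∀ S : Finset V, S.Nonempty → 0 ≤ z S) ∧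
  (∀ u : V, ∑ S ∈ univ.filter (fun S : Finset V => u ∈ S), z S = 1)

/-- `y_{uv}`: total weight of sets containing both `u` and `v`. -/
noncomputable def yPair (z : Finset V → ℝ) (u v : V) : ℝ :=
  ∑ S ∈ univ.filter (fun S : Finset V => u ∈ S ∧ v ∈ S), z S

/-- `x_{uv} := 1 - y_{uv}`. -/
noncomputable def xPair (z : Finset V → ℝ) (u v : V) : ℝ :=
  1 - yPair z u v

/-- `y_{uvw}`: total weight of sets containing `u`, `v` and `w`. -/
noncomputable def yTriple (z : Finset V → ℝ) (u v w : V) : ℝ :=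
  ∑ S ∈ univ.filter (fun S : Finset V => u ∈ S ∧ v ∈ S ∧ w ∈ S), z S

/-- `budget^+_α(x) := (α/(1-α/2)) · x²/(1+x)`. -/
noncomputable def budgetPlus (α x : ℝ) : ℝ :=
  (α / (1 - α / 2)) * (x ^ 2 / (1 + x))

/-- `budget^-_α(x) := (α/(1-α/2)) · (1+2x)(1-x)/(2(1+x))`. -/
noncomputable def budgetMinus (α x : ℝ) : ℝ :=
  (α / (1 - α / 2)) * ((1 + 2 * x) * (1 - x) / (2 * (1 + x)))

/-- `p_u(v)`: probability that `v` joins the cluster of pivot `u`.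
It is `1` if `uv` is a short `+`pair (`x_{uv} ≤ 0.4`) and `y_{uv}` otherwise. -/
noncomputable def pPiv (z : Finset V → ℝ) (plus : V → V → Bool) (u v : V) : ℝ :=
  if plus u v = true ∧ xPair z u v ≤ 0.4 then 1 else yPair z u v

/-- `q_u(v,w)`: probability that both `v` and `w` join the cluster of pivot `u`.
It is `y_{uvw}` if `uv` and `uw` are both long `+`pairs, and `p_u(v)·p_u(w)` otherwise. -/
noncomputable def qPiv (z : Finset V → ℝ) (plus : V → V → Bool) (u v w : V) : ℝ :=
  if (plus u v = true ∧ 0.4 < xPair z u v) ∧ (plus u w = true ∧ 0.4 < xPair z u w) then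
    yTriple z u v w
  else pPiv z plus u v * pPiv z plus u w

/-- The budget `b_{vw}` of a pair. -/
noncomputable def bPair (z : Finset V → ℝ) (plus : V → V → Bool) (α : ℝ) (v w : V) : ℝ :=
  if plus v w = true then budgetPlus α (xPair z v w) else budgetMinus α (xPair z v w)

/-- `cost_u(v,w)`. -/
noncomputable def costPiv (z : Finset V → ℝ) (plus : V → V → Bool) (u v w : V) : ℝ :=
  if plus v w = true then pPiv z plus u v + pPiv z plus u w - 2 * qPiv z plus u v w
  else qPiv z plus u v w

/-- `Delta_u(v,w)`. -/
noncomputable def deltaPiv (z : Finset V → ℝ) (plus : V → V → Bool) (α : ℝ) (u v w : V) : ℝ :=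
  (pPiv z plus u v + pPiv z plus u w - qPiv z plus u v w) * bPair z plus α v w

/-- `cost(T)` for a triangle `T = (u,v,w)`. -/
noncomputable def costTri (z : Finset V → ℝ) (plus : V → V → Bool) (u v w : V) : ℝ :=
  costPiv z plus u v w + costPiv z plus v u w + costPiv z plus w u v

/-- `Delta(T)` for a triangle `T = (u,v,w)`. -/
noncomputable def deltaTri (z : Finset V → ℝ) (plus : V → V → Bool) (α : ℝ) (u v w : V) : ℝ :=
  deltaPiv z plus α u v w + deltaPiv z plus α v u w + deltaPiv z plus α w u v

/-- `cost_u(u,v)` for a degenerate triangle. -/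
noncomputable def costDegPiv (z : Finset V → ℝ) (plus : V → V → Bool) (u v : V) : ℝ :=
  if plus u v = true then 1 - pPiv z plus u v else pPiv z plus u v

/-- `cost(T)` for a degenerate triangle `T = (u,v)`. -/
noncomputable def costDeg (z : Finset V → ℝ) (plus : V → V → Bool) (u v : V) : ℝ :=
  costDegPiv z plus u v + costDegPiv z plus v u

/-- `Delta(T)` for a degenerate triangle `T = (u,v)`. -/
noncomputable def deltaDeg (z : Finset V → ℝ) (plus : V → V → Bool) (α : ℝ) (u v : V) : ℝ :=
  2 * bPair z plus α u v

lemma yPair_comm (z : Finset V → ℝ) (u v : V) : yPair z u v = yPair z v u := by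
  simp only [yPair, and_comm]

lemma IsClusterLP.yPair_nonneg {z : Finset V → ℝ} (hz : IsClusterLP z) (u v : V) :
    0 ≤ yPair z u v :=
  Finset.sum_nonneg fun S hS => hz.1 S ⟨u, (Finset.mem_filter.1 hS).2.1⟩

lemma IsClusterLP.yPair_le_one {z : Finset V → ℝ} (hz : IsClusterLP z) (u v : V) :
    yPair z u v ≤ 1 := by
  rw [← hz.2 u]
  refine Finset.sum_le_sum_of_subset_of_nonneg (fun S hS => ?_)
    fun S hS _ => hz.1 S ⟨u, (Finset.mem_filter.1 hS).2⟩
  simp only [Finset.mem_filter] at hS ⊢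
  exact ⟨hS.1, hS.2.1⟩

lemma four_le_budget_factor {α : ℝ} (hα : α ∈ Set.Ico (4 / 3 : ℝ) 2) :
    4 ≤ α / (1 - α / 2) := by
  obtain ⟨h1, h2⟩ := hα
  rw [le_div_iff₀ (by linarith)]
  linarith

lemma budgetPlus_one_sub_nonneg {α c : ℝ} (hα : α ∈ Set.Ico (4 / 3 : ℝ) 2) (hc : c ≤ 1) :
    0 ≤ budgetPlus α (1 - c) :=
  mul_nonneg (by linarith [four_le_budget_factor hα])
    (div_nonneg (sq_nonneg _) (by linarith))

/-- The budget of a long `+`pair is at least its LP distance. -/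
lemma one_sub_le_budgetPlus {α c : ℝ} (hα : α ∈ Set.Ico (4 / 3 : ℝ) 2) (hc : c ≤ 0.6) :
    1 - c ≤ budgetPlus α (1 - c) := by
  norm_num at hc
  have h : (1 - c) / 4 ≤ (1 - c) ^ 2 / (1 + (1 - c)) := by
    rw [le_div_iff₀ (by linarith)]
    nlinarith
  have hK := four_le_budget_factor hα
  unfold budgetPlus
  nlinarith

lemma mul_three_sub_le_budgetMinus {α b : ℝ} (hα : α ∈ Set.Ico (4 / 3 : ℝ) 2)
    (hb0 : 0 ≤ b) (hb1 : b ≤ 1) : b * (3 - b) ≤ budgetMinus α (1 - b) := by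
  have h : b * (3 - b) / 4 ≤
      (1 + 2 * (1 - b)) * (1 - (1 - b)) / (2 * (1 + (1 - b))) := by
    rw [le_div_iff₀ (by linarith)]
    nlinarith [mul_nonneg (mul_nonneg hb0 hb0) (sub_nonneg.2 hb1)]
  have hK := four_le_budget_factor hα
  have h0 : 0 ≤ b * (3 - b) := mul_nonneg hb0 (by linarith)
  unfold budgetMinus
  nlinarith

/-- Cost of a triangle against its budget, with `a`, `b` the LP weights of the two `-`pairs and
`c` that of the `+`pair, when the `+`pair is short. -/
lemma short_plus_budget {α a b c : ℝ} (hα : α ∈ Set.Ico (4 / 3 : ℝ) 2)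
    (ha0 : 0 ≤ a) (ha1 : a ≤ 1) (hb0 : 0 ≤ b) (hb1 : b ≤ 1) (hc : c ≤ 1) :
    a + b - 2 * (a * b) + a + b ≤
      (a + b - a * b) * budgetPlus α (1 - c) + budgetMinus α (1 - b)
        + budgetMinus α (1 - a) := by
  have hP := budgetPlus_one_sub_nonneg hα hc
  have hA := mul_three_sub_le_budgetMinus hα ha0 ha1
  have hB := mul_three_sub_le_budgetMinus hα hb0 hb1
  have hq : 0 ≤ a + b - a * b := by nlinarith
  nlinarith [mul_nonneg hq hP, mul_nonneg ha0 hb0]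

/-- The analogue of `short_plus_budget` for a long `+`pair. -/
lemma long_plus_budget {α a b c : ℝ} (hα : α ∈ Set.Ico (4 / 3 : ℝ) 2)
    (ha0 : 0 ≤ a) (ha1 : a ≤ 1) (hb0 : 0 ≤ b) (hb1 : b ≤ 1) (hc0 : 0 ≤ c) (hc : c ≤ 0.6) :
    a + b - 2 * (a * b) + a * c + b * c ≤
      (a + b - a * b) * budgetPlus α (1 - c) + (a + c - a * c) * budgetMinus α (1 - b)
        + (b + c - b * c) * budgetMinus α (1 - a) := by
  have hc1 : c ≤ 1 := by norm_num at hc; linarith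
  have hP := one_sub_le_budgetPlus hα hc
  have hA := mul_three_sub_le_budgetMinus hα ha0 ha1
  have hB := mul_three_sub_le_budgetMinus hα hb0 hb1
  have hab : 0 ≤ a + b - a * b := by nlinarith
  have hac : 0 ≤ a + c - a * c := by nlinarith
  have hbc : 0 ≤ b + c - b * c := by nlinarith
  have h1 := mul_le_mul_of_nonneg_left hP hab
  have h2 := mul_le_mul_of_nonneg_left hB hac
  have h3 := mul_le_mul_of_nonneg_left hA hbc
  have e0 : 0 ≤ (1 - c) * (a * b * (7 - a - b)) :=
    mul_nonneg (sub_nonneg.2 hc1) (mul_nonneg (mul_nonneg ha0 hb0) (by linarith))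
  have e1 : 0 ≤ c * (a * (1 - a) + b * (1 - b) + 2 * (a * b)) :=
    mul_nonneg hc0 (by nlinarith [mul_nonneg ha0 hb0])
  linarith

theorem pmm_triangle_cost_le_budget [Nonempty V]
    (α : ℝ) (hα : α ∈ Set.Ico (4 / 3 : ℝ) 2)
    (plus : V → V → Bool) (hsym : ∀ a b : V, plus a b = plus b a)
    (z : Finset V → ℝ) (hz : IsClusterLP z)
    (u v w : V) (huv : u ≠ v) (huw : u ≠ w) (hvw : v ≠ w)
    (hone : (plus u v = true ∧ plus u w = false ∧ plus v w = false) ∨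
            (plus u w = true ∧ plus u v = false ∧ plus v w = false) ∨
            (plus v w = true ∧ plus u v = false ∧ plus u w = false)) :
    costTri z plus u v w ≤ deltaTri z plus α u v w := by
  have hsm : ∀ {a b : V}, plus a b = false → plus b a = false := fun h => by rwa [hsym]
  have hsp : ∀ {a b : V}, plus a b = true → plus b a = true := fun h => by rwa [hsym]
  have hn := hz.yPair_nonneg
  have hl := hz.yPair_le_one
  rcases hone with ⟨h1, h2, h3⟩ | ⟨h1, h2, h3⟩ | ⟨h1, h2, h3⟩
  all_goals
    simp only [costTri, deltaTri, costPiv, deltaPiv, qPiv, pPiv, bPair, xPair, h1, h2, h3,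
      hsp h1, hsm h2, hsm h3, yPair_comm z v u, yPair_comm z w u, yPair_comm z w v]
  · by_cases hs : 1 - yPair z u v ≤ 0.4
    · have := short_plus_budget hα (hn u w) (hl u w) (hn v w) (hl v w) (hl u v)
      simp [hs]
      linarith
    · have := long_plus_budget hα (hn u w) (hl u w) (hn v w) (hl v w) (hn u v)
        (by norm_num at hs ⊢; linarith)
      simp [hs]
      linarith
  · by_cases hs : 1 - yPair z u w ≤ 0.4
    · have := short_plus_budget hα (hn u v) (hl u v) (hn v w) (hl v w) (hl u w)
      simp [hs]
      linarith
    · have := long_plus_budget hα (hn u v) (hl u v) (hn v w) (hl v w) (hn u w)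
        (by norm_num at hs ⊢; linarith)
      simp [hs]
      linarith
  · by_cases hs : 1 - yPair z v w ≤ 0.4
    · have := short_plus_budget hα (hn u v) (hl u v) (hn u w) (hl u w) (hl v w)
      simp [hs]
      linarith
    · have := long_plus_budget hα (hn u v) (hl u v) (hn u w) (hl u w) (hn v w)
        (by norm_num at hs ⊢; linarith)
      simp [hs]
      linarith
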